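/- For every natural number n ≥ 4, the number of 4-cliques of the standard spherical triangulation S_n is exactly n − 3. -/

import Mathlib

/-- The standard spherical triangulation `S_n` on vertex set `{0, 1, ..., n-1}`:
edges are `0–1`; `0–i` and `1–i` for `2 ≤ i ≤ n-1`; and `i–(i+1)` for `2 ≤ i ≤ n-2`. -/
def stdSphere (n : ℕ) : SimpleGraph (Fin n) :=
  SimpleGraph.fromRel (fun i j =>
    (i.val = 0 ∧ j.val = 1) ∨ (i.val = 0 ∧ 2 ≤ j.val) ∨ (i.val = 1 ∧ 2 ≤ j.val) ∨
      (2 ≤ i.val ∧ j.val = i.val + 1))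

theorem stdSphere_adj_iff_of_lt {n : ℕ} {i j : Fin n} (h : i < j) :
    (stdSphere n).Adj i j ↔ i.val ≤ 1 ∨ j.val = i.val + 1 := by
  have h' : i.val < j.val := h
  have hne : i ≠ j := h.ne
  simp only [stdSphere, SimpleGraph.fromRel_adj, hne, ne_eq, not_false_eq_true, true_and]
  omega

theorem Finset.exists_lt_lt_lt_of_card_eq_four {α : Type*} [LinearOrder α] {t : Finset α}
    (ht : t.card = 4) : ∃ a b c d, a < b ∧ b < c ∧ c < d ∧ t = {a, b, c, d} := by
  let f := t.orderEmbOfFin ht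
  refine ⟨f 0, f 1, f 2, f 3, f.strictMono (by decide), f.strictMono (by decide),
    f.strictMono (by decide), ?_⟩
  have huniv : (Finset.univ : Finset (Fin 4)) = {0, 1, 2, 3} := rfl
  have himage := Finset.image_orderEmbOfFin_univ t ht
  rw [huniv] at himage
  simpa [Finset.image_insert] using himage.symm

/-- For every `n ≥ 4`, the number of 4-cliques of `S_n` is exactly `n - 3`. -/
theorem stdSphere_four_cliques (n : ℕ) (hn : 4 ≤ n) :
    {t : Finset (Fin n) | (stdSphere n).IsNClique 4 t}.ncard = n - 3 := by
  let f : Fin (n - 3) → Finset (Fin n) := fun k =>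
    {⟨0, by omega⟩, ⟨1, by omega⟩, ⟨k + 2, by omega⟩, ⟨k + 3, by omega⟩}
  have hf : Function.Injective f := by
    intro k l h
    have hk : (⟨k + 2, by omega⟩ : Fin n) ∈ f l := h ▸ by simp [f]
    have hl : (⟨l + 2, by omega⟩ : Fin n) ∈ f k := h ▸ by simp [f]
    simp only [f, Finset.mem_insert, Finset.mem_singleton, Fin.mk.injEq] at hk hl
    omega
  have hrange : {t : Finset (Fin n) | (stdSphere n).IsNClique 4 t} = Set.range f := by
    ext t
    simp only [Set.mem_ofPred_eq, Set.mem_range]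
    constructor
    · intro ht
      obtain ⟨a, b, c, d, hab, hbc, hcd, rfl⟩ :=
        Finset.exists_lt_lt_lt_of_card_eq_four ht.card_eq
      have hadj {i j : Fin n} (hi : i ∈ ({a, b, c, d} : Finset (Fin n)))
          (hj : j ∈ ({a, b, c, d} : Finset (Fin n))) (hij : i < j) :
          i.val ≤ 1 ∨ j.val = i.val + 1 :=
        (stdSphere_adj_iff_of_lt hij).1 (ht.isClique hi hj hij.ne)
      have hbd := hadj (i := b) (j := d) (by simp) (by simp) (hbc.trans hcd)
      have hcd' := hadj (i := c) (j := d) (by simp) (by simp) hcd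
      rw [Fin.lt_def] at hab hbc hcd
      refine ⟨⟨c - 2, by omega⟩, ?_⟩
      have ha : a = ⟨0, by omega⟩ := Fin.ext (by simp only; omega)
      have hb : b = ⟨1, by omega⟩ := Fin.ext (by simp only; omega)
      have hc : c = ⟨c - 2 + 2, by omega⟩ := Fin.ext (by simp only; omega)
      have hd : d = ⟨c - 2 + 3, by omega⟩ := Fin.ext (by simp only; omega)
      simp only [f, ← ha, ← hb, ← hc, ← hd]
    · rintro ⟨k, rfl⟩
      refine ⟨?_, ?_⟩
      · intro i hi j hj hij
        wlog h : i < j generalizing i j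
        · exact (this hj hi hij.symm (lt_of_le_of_ne (not_lt.1 h) hij.symm)).symm
        · rw [stdSphere_adj_iff_of_lt h]
          rw [Fin.lt_def] at h
          simp only [f, Finset.mem_coe, Finset.mem_insert, Finset.mem_singleton,
            Fin.ext_iff] at hi hj
          omega
      · simp [f]
  rw [hrange, Set.ncard_range_of_injective hf, Nat.card_fin]
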